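/- If f is a strictly locally 1-to-1 continuous map defined on an arclike continuum X, then f(X) is a 2-to-1 retract of a continuum. -/

import Mathlib

open Set Metric Topology

/-- A subcontinuum of a topological space: a nonempty compact connected subset. -/
def IsSubcontinuum {X : Type*} [TopologicalSpace X] (K : Set X) : Prop :=
  IsCompact K ∧ IsConnected K

/-- The metric space `Y` is an `m`-to-1 retract of a continuum: there is a continuum `X`,
a subcontinuum `Y'` of `X` homeomorphic to `Y`, and a continuous retraction of `X` onto `Y'`
under which every point of `Y'` has exactly `m` preimages. -/
def IsMToOneRetract (m : ℕ) (Y : Type*) [MetricSpace Y] : Prop :=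
  ∃ (X : Type) (_ : MetricSpace X), CompactSpace X ∧ ConnectedSpace X ∧ Nonempty X ∧
    ∃ Y' : Set X, IsSubcontinuum Y' ∧ Nonempty (Y ≃ₜ Y') ∧
      ∃ r : X → X, Continuous r ∧ (∀ x, r x ∈ Y') ∧ (∀ y ∈ Y', r y = y) ∧
        ∀ y ∈ Y', {x : X | r x = y}.ncard = m

/-- A 1-to-1 cover of a map `f` : a restriction of `f` to an open proper subset `U`
of the domain such that `f` is injective on `U` and `f(U) = f(X)`. -/
def HasOneToOneCover {X Y : Type*} [TopologicalSpace X] (f : X → Y) : Prop :=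
  ∃ U : Set X, IsOpen U ∧ U ≠ Set.univ ∧ Set.InjOn f U ∧ f '' U = Set.range f

/-- Strictly locally 1-to-1: locally injective but not injective. -/
def StrictlyLocallyInjective {X Y : Type*} [TopologicalSpace X] (f : X → Y) : Prop :=
  (∀ x : X, ∃ U ∈ 𝓝 x, Set.InjOn f U) ∧ ¬ Function.Injective f

/-- A map is simple if each point-inverse of a point of the image has cardinality one or two. -/
def SimpleMap {X Y : Type*} (f : X → Y) : Prop :=
  ∀ y ∈ Set.range f, (f ⁻¹' {y}).ncard = 1 ∨ (f ⁻¹' {y}).ncard = 2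

/-- `f` is injective on each proper subcontinuum of its domain. -/
def InjOnProperSubcontinua {X Y : Type*} [TopologicalSpace X] (f : X → Y) : Prop :=
  ∀ K : Set X, IsSubcontinuum K → K ≠ Set.univ → Set.InjOn f K

/-- Two sets are separated if neither contains a limit point of the other. -/
def SeparatedSets {X : Type*} [TopologicalSpace X] (A B : Set X) : Prop :=
  Disjoint (closure A) B ∧ Disjoint A (closure B)

/-- Every subcontinuum with more than one point is the union of two proper subcontinua. -/
def HereditarilyDecomposable (X : Type*) [TopologicalSpace X] : Prop :=
  ∀ K : Set X, IsSubcontinuum K → K.Nontrivial →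
    ∃ A B : Set X, IsSubcontinuum A ∧ IsSubcontinuum B ∧
      A ⊆ K ∧ B ⊆ K ∧ A ≠ K ∧ B ≠ K ∧ A ∪ B = K

/-- Arclike: for each `ε > 0` there is an `ε`-map onto `[0,1]`. -/
def Arclike (X : Type*) [MetricSpace X] : Prop :=
  ∀ ε > (0:ℝ), ∃ g : X → ℝ, Continuous g ∧ Set.range g = Set.Icc 0 1 ∧
    ∀ t : ℝ, Metric.diam (g ⁻¹' {t}) < ε

/-- A tree: a connected finite graph (a continuum that is a finite union of arcs meeting
only at endpoints) containing no simple closed curve. -/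
def IsTree (T : Type*) [MetricSpace T] : Prop :=
  CompactSpace T ∧ ConnectedSpace T ∧ Nonempty T ∧
    (∃ (n : ℕ) (γ : Fin n → ℝ → T),
      (∀ i, ContinuousOn (γ i) (Set.Icc 0 1) ∧ Set.InjOn (γ i) (Set.Icc 0 1)) ∧
      (⋃ i, γ i '' Set.Icc 0 1) = Set.univ ∧
      (∀ i j, i ≠ j →
        (γ i '' Set.Icc 0 1) ∩ (γ j '' Set.Icc 0 1) ⊆
          ({γ i 0, γ i 1, γ j 0, γ j 1} : Set T))) ∧
    ¬ ∃ S : Set T, Nonempty (S ≃ₜ (Metric.sphere (0:ℂ) 1))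

/-- Treelike: for each `ε > 0` there is an `ε`-map onto a tree. -/
def Treelike (X : Type*) [MetricSpace X] : Prop :=
  ∀ ε > (0:ℝ), ∃ (T : Type) (_ : MetricSpace T), IsTree T ∧
    ∃ g : X → T, Continuous g ∧ Function.Surjective g ∧
      ∀ t : T, Metric.diam (g ⁻¹' {t}) < ε

/-- A locally injective map on a compact metric space separates distinct points that
are uniformly close. -/
theorem exists_pos_forall_dist_lt_injective {X Y : Type*} [MetricSpace X] [CompactSpace X]
    {f : X → Y} (h : ∀ x : X, ∃ U ∈ 𝓝 x, Set.InjOn f U) :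
    ∃ δ > 0, ∀ x x' : X, dist x x' < δ → f x = f x' → x = x' := by
  choose U hU hinj using h
  obtain ⟨δ, hδ, hb⟩ := lebesgue_number_lemma_of_metric (s := (Set.univ : Set X))
    (c := fun x => interior (U x)) isCompact_univ (fun _ => isOpen_interior)
    (fun x _ => Set.mem_iUnion.2 ⟨x, mem_interior_iff_mem_nhds.2 (hU x)⟩)
  refine ⟨δ, hδ, fun x x' hd he => ?_⟩
  obtain ⟨i, hi⟩ := hb x (Set.mem_univ x)
  exact hinj i (interior_subset (hi (mem_ball_self hδ)))
    (interior_subset (hi (by rwa [mem_ball, dist_comm]))) he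

/-- A strictly locally injective map on an arclike continuum has a 1-to-1 cover: in each fibre,
keep the point at which a fine map to `[0,1]` is smallest. -/
theorem Arclike.hasOneToOneCover {X Y : Type*} [MetricSpace X] [CompactSpace X] [MetricSpace Y]
    (harc : Arclike X) {f : X → Y} (hf : Continuous f) (hsl : StrictlyLocallyInjective f) :
    HasOneToOneCover f := by
  obtain ⟨δ, hδ, hinj⟩ := exists_pos_forall_dist_lt_injective hsl.1
  obtain ⟨g, hg, -, hdiam⟩ := harc δ hδ
  have hfg : ∀ x x', f x = f x' → g x = g x' → x = x' := fun x x' he hge =>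
    hinj x x' ((dist_le_diam_of_mem (isCompact_univ.isBounded.subset (Set.subset_univ _))
      (show x ∈ g ⁻¹' {g x'} from hge) rfl).trans_lt (hdiam _)) he
  have hclosed : IsClosed {p : X × X | δ ≤ dist p.1 p.2 ∧ f p.1 = f p.2 ∧ g p.2 ≤ g p.1} := by
    have hle : IsClosed {p : X × X | δ ≤ dist p.1 p.2} :=
      isClosed_le (by fun_prop) (by fun_prop)
    have heq : IsClosed {p : X × X | f p.1 = f p.2} :=
      isClosed_eq (by fun_prop) (by fun_prop)
    have hge : IsClosed {p : X × X | g p.2 ≤ g p.1} :=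
      isClosed_le (by fun_prop) (by fun_prop)
    exact hle.inter (heq.inter hge)
  have hproj : {x | ∀ x', f x = f x' → g x ≤ g x'}ᶜ =
      Prod.fst '' {p : X × X | δ ≤ dist p.1 p.2 ∧ f p.1 = f p.2 ∧ g p.2 ≤ g p.1} := by
    ext x
    simp only [Set.mem_compl_iff, Set.mem_ofPred_eq, not_forall, not_le, Set.mem_image,
      Prod.exists, exists_and_right, exists_eq_right]
    constructor
    · rintro ⟨x', he, hlt⟩
      refine ⟨x', ?_, he, hlt.le⟩
      by_contra! hd
      exact hlt.ne' (congrArg g (hinj x x' hd he))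
    · rintro ⟨x', hd, he, hle⟩
      refine ⟨x', he, hle.lt_of_ne fun hge => ?_⟩
      rw [hfg x x' he hge.symm, dist_self] at hd
      exact hd.not_gt hδ
  refine ⟨{x | ∀ x', f x = f x' → g x ≤ g x'}, ?_, ?_, ?_, ?_⟩
  · rw [← isClosed_compl_iff, hproj]
    exact (hclosed.isCompact.image continuous_fst).isClosed
  · intro huniv
    refine hsl.2 fun x x' he => hfg x x' he (le_antisymm ?_ ?_)
    · exact (huniv ▸ Set.mem_univ x : x ∈ {x | ∀ x', f x = f x' → g x ≤ g x'}) x' he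
    · exact (huniv ▸ Set.mem_univ x' : x' ∈ {x | ∀ x', f x = f x' → g x ≤ g x'}) x he.symm
  · exact fun x hx x' hx' he => hfg x x' he (le_antisymm (hx x' he) (hx' x he.symm))
  · refine Set.Subset.antisymm (Set.image_subset_range _ _) ?_
    rintro _ ⟨x, rfl⟩
    obtain ⟨m, hm, hmin⟩ := ((isClosed_singleton.preimage hf).isCompact :
      IsCompact (f ⁻¹' {f x})).exists_isMinOn ⟨x, rfl⟩ hg.continuousOn
    exact ⟨m, fun x' he => hmin (show f x' = f x from he.symm.trans hm), hm⟩

/-- The image of a continuum under a map with a 1-to-1 cover is a 2-to-1 retract of a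
continuum: attach to `f(X)` the graph over the cover `U` of the distance to the complement
of `U`. -/
theorem HasOneToOneCover.isMToOneRetract_two {X Y : Type} [MetricSpace X] [CompactSpace X]
    [ConnectedSpace X] [MetricSpace Y] {f : X → Y} (hf : Continuous f)
    (h : HasOneToOneCover f) : IsMToOneRetract 2 ↥(Set.range f) := by
  obtain ⟨U, hUo, hU, hinj, himg⟩ := h
  have hne : Uᶜ.Nonempty := Set.nonempty_compl.2 hU
  let F : X → Y × ℝ := fun x => (f x, infDist x Uᶜ)
  let G : X → Y × ℝ := fun x => (f x, 0)
  have hF : Continuous F := by fun_prop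
  have hG : Continuous G := by fun_prop
  have hFG : ∀ x ∉ U, F x = G x := fun x hx => by
    simp [F, G, infDist_zero_of_mem (show x ∈ Uᶜ from hx)]
  have hFU : ∀ x ∈ U, 0 < infDist x Uᶜ := fun x hx =>
    (hUo.isClosed_compl.notMem_iff_infDist_pos hne).1 (not_not_intro hx)
  let Z : Set (Y × ℝ) := Set.range G ∪ Set.range F
  have hZc : IsCompact Z := (isCompact_range hG).union (isCompact_range hF)
  have hZconn : IsConnected Z := by
    obtain ⟨x, hx⟩ := hne
    exact (isConnected_range hG).union ⟨G x, ⟨x, rfl⟩, x, hFG x hx⟩ (isConnected_range hF)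
  have hZfst : ∀ z : Z, z.1.1 ∈ Set.range f := by
    rintro ⟨_, ⟨x, rfl⟩ | ⟨x, rfl⟩⟩ <;> exact ⟨x, rfl⟩
  have : CompactSpace Z := isCompact_iff_compactSpace.1 hZc
  have : ConnectedSpace Z := isConnected_iff_connectedSpace.1 hZconn
  have : CompactSpace (Set.range f) := isCompact_iff_compactSpace.1 (isCompact_range hf)
  have : ConnectedSpace (Set.range f) := isConnected_iff_connectedSpace.1 (isConnected_range hf)
  let e : Set.range f → Z := fun y => ⟨(y.1, 0), Or.inl (by
    obtain ⟨_, x, rfl⟩ := y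
    exact ⟨x, rfl⟩)⟩
  have he : Continuous e := by fun_prop
  have hei : Function.Injective e := fun y y' hy =>
    Subtype.ext (congrArg (fun z : Z => z.1.1) hy)
  refine ⟨Z, inferInstance, inferInstance, inferInstance, inferInstance, Set.range e,
    ⟨isCompact_range he, isConnected_range he⟩,
    ⟨(he.isClosedEmbedding hei).isEmbedding.toHomeomorph⟩,
    fun z => e ⟨z.1.1, hZfst z⟩, by fun_prop, fun z => ⟨_, rfl⟩, ?_, ?_⟩
  · rintro _ ⟨y, rfl⟩
    rfl
  · rintro _ ⟨⟨y, hy⟩, rfl⟩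
    obtain ⟨u, hu, rfl⟩ := himg.symm ▸ hy
    have hfib : {z : Z | e ⟨z.1.1, hZfst z⟩ = e ⟨f u, hy⟩} =
        {e ⟨f u, hy⟩, ⟨F u, Or.inr ⟨u, rfl⟩⟩} := by
      ext ⟨z, hz⟩
      constructor
      · intro hzu
        replace hzu : z.1 = f u := congrArg Subtype.val (hei hzu)
        rcases hz with ⟨x, rfl⟩ | ⟨x, rfl⟩
        · exact Or.inl (Subtype.ext (Prod.ext hzu rfl))
        · by_cases hx : x ∈ U
          · exact Or.inr (Subtype.ext (congrArg F (hinj hx hu hzu)))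
          · exact Or.inl (Subtype.ext ((hFG x hx).trans (Prod.ext hzu rfl)))
      · rintro (h | h)
        · exact congrArg e (Subtype.ext (congrArg (fun z : Z => z.1.1) h))
        · exact congrArg e (Subtype.ext (congrArg (fun z : Z => z.1.1) h))
    rw [hfib]
    exact Set.ncard_pair fun heq =>
      (hFU u hu).ne (congrArg (fun z : Z => z.1.2) heq)

/-- The image of a strictly locally 1-to-1 map defined on an arclike continuum is a
2-to-1 retract of a continuum. -/
theorem image_of_arclike_strictlyLocallyInjective_is_retract
    (X Y : Type) [MetricSpace X] [CompactSpace X] [ConnectedSpace X] [Nonempty X]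
    [MetricSpace Y] (harc : Arclike X)
    (f : X → Y) (hf : Continuous f) (hsl : StrictlyLocallyInjective f) :
    IsMToOneRetract 2 ↥(Set.range f) := by
  exact (harc.hasOneToOneCover hf hsl).isMToOneRetract_two hf
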